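/- Let g be an integer, n ≥ 2 an integer, and m₁, …, mₙ integers with mᵢ ≥ 1 for all i. Set κ_μ = (2g − 2 + n) − Σᵢ₌₁ⁿ 1/(mᵢ + 1), κ_{μ'} = (2g − 2 + (n − 1)) − 1/(m₁ + m₂ + 1) − Σᵢ₌₃ⁿ 1/(mᵢ + 1), and c = (m₁ + m₂ + 1)·(1 − 1/(m₁ + 1) − 1/(m₂ + 1) + 1/(m₁ + m₂ + 1)). Let V be a vector space over ℚ, let λ, D, η, P ∈ V satisfy 12·λ − D − κ_μ·η = c·P, and let C : V → ℚ be a linear map with C(12·λ − D) = κ_{μ'}·C(η) and C(η) > 0. Then C(P) = −C(η)/(m₁ + m₂ + 1), and in particular C(P) < 0. -/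

import Mathlib

/-- Splitting off the first two terms of a sum over `Fin n`. -/
theorem Fin.sum_eq_add_add_sum_filter_two_le {M : Type*} [AddCommMonoid M] {n : ℕ}
    (hn : 2 ≤ n) (f : Fin n → M) :
    ∑ i, f i = f ⟨0, zero_lt_two.trans_le hn⟩ + f ⟨1, one_lt_two.trans_le hn⟩
      + ∑ i ∈ Finset.univ.filter (fun i : Fin n => 2 ≤ (i : ℕ)), f i := by
  obtain ⟨k, rfl⟩ := Nat.exists_eq_add_of_le' hn
  rw [Finset.sum_filter, Fin.sum_univ_succ, Fin.sum_univ_succ, Fin.sum_univ_succ,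
    Fin.sum_univ_succ]
  simp [add_assoc]

/-- Negative intersection argument for Theorem 1.4 (abelian case): from the divisor
class relation `12λ - D - κ_μ η = c P` and a linear functional `C` (intersection with
the closure of a Teichmüller curve) satisfying `C(12λ - D) = κ_{μ'} C(η)` and
`C(η) > 0`, one gets `C(P) = -C(η)/(m₁+m₂+1) < 0`. -/
theorem stmt_13 (g : ℤ) (n : ℕ) (hn : 2 ≤ n) (m : Fin n → ℤ) (hm : ∀ i, 1 ≤ m i)
    (V : Type*) [AddCommGroup V] [Module ℚ V]
    (lam D η P : V) (C : V →ₗ[ℚ] ℚ) (κμ κμ' c : ℚ)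
    (hκμ : κμ = ((2 * g - 2 + n : ℤ) : ℚ) - ∑ i, 1 / ((m i : ℚ) + 1))
    (hκμ' : κμ' = (((2 * g - 2 + ((n : ℤ) - 1)) : ℤ) : ℚ)
      - 1 / ((m ⟨0, by omega⟩ : ℚ) + (m ⟨1, by omega⟩ : ℚ) + 1)
      - ∑ i ∈ Finset.univ.filter (fun i : Fin n => 2 ≤ (i : ℕ)), 1 / ((m i : ℚ) + 1))
    (hc : c = ((m ⟨0, by omega⟩ : ℚ) + (m ⟨1, by omega⟩ : ℚ) + 1) *
      (1 - 1 / ((m ⟨0, by omega⟩ : ℚ) + 1) - 1 / ((m ⟨1, by omega⟩ : ℚ) + 1)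
        + 1 / ((m ⟨0, by omega⟩ : ℚ) + (m ⟨1, by omega⟩ : ℚ) + 1)))
    (hrel : (12 : ℚ) • lam - D - κμ • η = c • P)
    (hC : C ((12 : ℚ) • lam - D) = κμ' * C η)
    (hpos : 0 < C η) :
    C P = -(C η) / ((m ⟨0, by omega⟩ : ℚ) + (m ⟨1, by omega⟩ : ℚ) + 1) ∧
    C P < 0 := by
  have hsum := Fin.sum_eq_add_add_sum_filter_two_le hn (fun i => 1 / ((m i : ℚ) + 1))
  have ha : (1 : ℚ) ≤ m ⟨0, by omega⟩ := by exact_mod_cast hm _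
  have hb : (1 : ℚ) ≤ m ⟨1, by omega⟩ := by exact_mod_cast hm _
  rw [hsum] at hκμ
  push_cast at hκμ hκμ'
  generalize (m ⟨0, by omega⟩ : ℚ) = a at *
  generalize (m ⟨1, by omega⟩ : ℚ) = b at *
  have hM : 0 < a + b + 1 := by linarith
  have ha2 : 1 / (a + 1) ≤ 1 / 2 := one_div_le_one_div_of_le (by norm_num) (by linarith)
  have hb2 : 1 / (b + 1) ≤ 1 / 2 := one_div_le_one_div_of_le (by norm_num) (by linarith)
  have hM2 : 0 < 1 / (a + b + 1) := one_div_pos.mpr hM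
  have hc0 : 0 < c := by
    rw [hc]
    exact mul_pos hM (by linarith)
  have hκ : κμ' - κμ = -(c / (a + b + 1)) := by
    rw [hc, mul_div_cancel_left₀ _ hM.ne', hκμ, hκμ']
    ring
  have hCP : (κμ' - κμ) * C η = c * C P := by
    have h := congrArg C hrel
    rw [map_sub, hC, map_smul, map_smul, smul_eq_mul, smul_eq_mul] at h
    linarith
  have key : C P = -(C η) / (a + b + 1) := by
    apply mul_left_cancel₀ hc0.ne'
    rw [← hCP, hκ]
    ring
  exact ⟨key, key ▸ div_neg_of_neg_of_pos (neg_lt_zero.mpr hpos) hM⟩
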